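/- arXiv:math/0510060 — 2 statements merged into one kernel-verified Lean document; each statement's English description precedes it below -/
import Mathlib

section
/- Let p be a prime and n a natural number. For each p-class regular partition μ of n, choose a permutation x_μ ∈ S_n with cycle type μ. Then the multiset { |Z_{S_n}(x_μ)|_p : μ a p-class regular partition of n } of p-parts of centralizer orders of representatives of the p-regular conjugacy classes of S_n equals the multiset { p^{(ℓ(γ(λ)) − ℓ(λ))/(p−1)} : λ a p-regular partition of n }. (By Brauer's theorem that the elementary divisors of the p-Cartan matrix of a finite group G are the p-parts |Z_G(x)|_p over representatives x of the p-regular classes, this multiset is the multiset of elementary divisors of the p-Cartan matrix of S_n.) -/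
/-- The multiset-level Glaisher map: each part `a = p ^ v * q` with `p ∤ q`
is replaced by `p ^ v` copies of `q`. -/
def glaisherParts (p : ℕ) (s : Multiset ℕ) : Multiset ℕ :=
  s.bind fun a =>
    Multiset.replicate (p ^ (a.factorization p)) (a / p ^ (a.factorization p))

/-- A partition is `p`-regular if no part occurs `p` (or more) times. -/
def IsPRegular (p : ℕ) {n : ℕ} (lam : n.Partition) : Prop :=
  ∀ a : ℕ, lam.parts.count a < p

/-- A partition is `p`-class regular if no part is divisible by `p`. -/
def IsPClassRegular (p : ℕ) {n : ℕ} (mu : n.Partition) : Prop :=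
  ∀ a ∈ mu.parts, ¬ p ∣ a

/-- The multiplicity of `q`, prime to `p`, after replacing each part `a = p ^ v * q`
by `c v` copies of `q`. -/
lemma count_bind_replicate_pow {p q N : ℕ} (hp : p.Prime) (hq : ¬ p ∣ q) (c : ℕ → ℕ)
    (s : Multiset ℕ) (hs : ∀ a ∈ s, a.factorization p < N) :
    (s.bind fun a => Multiset.replicate (c (a.factorization p))
      (a / p ^ (a.factorization p))).count q
      = ∑ i ∈ Finset.range N, c i * s.count (p ^ i * q) := by
  have hq0 : q ≠ 0 := by rintro rfl; simp at hq
  have hfac (i : ℕ) : (p ^ i * q).factorization p = i := by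
    rw [Nat.factorization_mul (pow_ne_zero _ hp.ne_zero) hq0]
    simp [hp.factorization_self, Nat.factorization_eq_zero_of_not_dvd hq]
  induction s using Multiset.induction_on with
  | empty => simp
  | cons a s ih =>
    rw [Multiset.cons_bind, Multiset.count_add,
      ih fun b hb => hs b (Multiset.mem_cons_of_mem hb)]
    simp only [Multiset.count_cons, mul_add, Finset.sum_add_distrib]
    rw [add_comm, Multiset.count_replicate]
    congr 1
    split_ifs with h
    · have ha : p ^ a.factorization p * q = a := by
        rw [← h]; exact Nat.ordProj_mul_ordCompl_eq_self a p
      rw [Finset.sum_eq_single (a.factorization p)]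
      · simp [ha]
      · intro i _ hi
        rw [if_neg, mul_zero]
        intro h'
        exact hi (by rw [← h', hfac])
      · intro h'
        exact absurd (Finset.mem_range.2 (hs a (Multiset.mem_cons_self a s))) h'
    · symm
      refine Finset.sum_eq_zero fun i _ => ?_
      rw [if_neg, mul_zero]
      rintro rfl
      apply h
      rw [hfac, Nat.mul_div_cancel_left _ (pow_pos hp.pos i)]

lemma sum_digits_sum_pow_mul {p : ℕ} (hp : 1 < p) (N : ℕ) (f : ℕ → ℕ) (hf : ∀ i, f i < p) :
    (p.digits (∑ i ∈ Finset.range N, p ^ i * f i)).sum = ∑ i ∈ Finset.range N, f i := by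
  induction N generalizing f with
  | zero => simp
  | succ N ih =>
    have h : ∑ i ∈ Finset.range (N + 1), p ^ i * f i
        = f 0 + p * ∑ i ∈ Finset.range N, p ^ i * f (i + 1) := by
      rw [Finset.sum_range_succ', Finset.mul_sum, add_comm]
      simp [pow_succ', mul_assoc]
    rw [h, Finset.sum_range_succ', ← ih (fun i => f (i + 1)) fun i => hf _]
    by_cases h0 : f 0 = 0 ∧ ∑ i ∈ Finset.range N, p ^ i * f (i + 1) = 0
    · simp [h0.1, h0.2]
    · rw [Nat.digits_add p hp _ _ (hf 0) (by tauto), List.sum_cons, add_comm]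

lemma eq_of_sum_pow_mul_eq {p : ℕ} (N : ℕ) (f g : ℕ → ℕ) (hf : ∀ i, f i < p)
    (hg : ∀ i, g i < p)
    (h : ∑ i ∈ Finset.range N, p ^ i * f i = ∑ i ∈ Finset.range N, p ^ i * g i) :
    ∀ i < N, f i = g i := by
  induction N generalizing f g with
  | zero => simp
  | succ N ih =>
    have key (f : ℕ → ℕ) : ∑ i ∈ Finset.range (N + 1), p ^ i * f i
        = f 0 + p * ∑ i ∈ Finset.range N, p ^ i * f (i + 1) := by
      rw [Finset.sum_range_succ', Finset.mul_sum, add_comm]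
      simp [pow_succ', mul_assoc]
    rw [key, key] at h
    have h0 : f 0 = g 0 := by
      have := congrArg (· % p) h
      simpa [Nat.add_mul_mod_self_left, Nat.mod_eq_of_lt, hf, hg] using this
    have hp : 0 < p := (Nat.zero_le _).trans_lt (hf 0)
    rw [h0, Nat.add_left_cancel_iff] at h
    intro i hi
    cases i with
    | zero => exact h0
    | succ i =>
      exact ih (fun i => f (i + 1)) (fun i => g (i + 1)) (fun i => hf _) (fun i => hg _)
        (Nat.eq_of_mul_eq_mul_left hp h) i (by omega)

lemma sum_glaisherParts (p : ℕ) (s : Multiset ℕ) : (glaisherParts p s).sum = s.sum := by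
  induction s using Multiset.induction_on with
  | empty => simp [glaisherParts]
  | cons a s ih =>
    rw [glaisherParts] at *
    rw [Multiset.cons_bind, Multiset.sum_add, ih, Multiset.sum_replicate, Multiset.sum_cons,
      smul_eq_mul, Nat.ordProj_mul_ordCompl_eq_self]

lemma not_dvd_of_mem_glaisherParts {p : ℕ} (hp : p.Prime) {s : Multiset ℕ}
    (hs : ∀ a ∈ s, 0 < a) {b : ℕ} (hb : b ∈ glaisherParts p s) : ¬ p ∣ b := by
  simp only [glaisherParts, Multiset.mem_bind, Multiset.mem_replicate] at hb
  obtain ⟨a, ha, -, rfl⟩ := hb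
  exact Nat.not_dvd_ordCompl hp (hs a ha).ne'

/-- The Glaisher map from `p`-regular to `p`-class regular partitions. -/
def glaisherMap {p n : ℕ} (hp : p.Prime) (lam : {lam : n.Partition // IsPRegular p lam}) :
    {mu : n.Partition // IsPClassRegular p mu} :=
  ⟨{ parts := glaisherParts p lam.1.parts
     parts_pos := fun {i} hi => Nat.pos_of_ne_zero fun h0 =>
       not_dvd_of_mem_glaisherParts hp (fun _ ha => lam.1.parts_pos ha) hi (h0 ▸ dvd_zero p)
     parts_sum := by rw [sum_glaisherParts, lam.1.parts_sum] },
    fun _ ha => not_dvd_of_mem_glaisherParts hp (fun _ hb => lam.1.parts_pos hb) ha⟩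

lemma Nat.Partition.factorization_lt_of_mem {n : ℕ} (p : ℕ) (lam : n.Partition) {a : ℕ}
    (ha : a ∈ lam.parts) : a.factorization p < n + 1 :=
  (Nat.factorization_lt p (lam.parts_pos ha).ne').trans_le
    ((lam.le_of_mem_parts ha).trans n.le_succ)

lemma glaisherMap_injective {p n : ℕ} (hp : p.Prime) :
    Function.Injective (glaisherMap (n := n) hp) := by
  rintro ⟨lam, hlam⟩ ⟨nu, hnu⟩ h
  have hparts : glaisherParts p lam.parts = glaisherParts p nu.parts :=
    congrArg (fun t => t.1.parts) h
  refine Subtype.ext (Nat.Partition.ext (Multiset.ext.2 fun a => ?_))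
  by_cases ha : 0 < a ∧ a ≤ n
  · obtain ⟨ha0, han⟩ := ha
    have hq := Nat.not_dvd_ordCompl hp ha0.ne'
    have hcount := congrArg (Multiset.count (a / p ^ a.factorization p)) hparts
    rw [glaisherParts, glaisherParts,
      count_bind_replicate_pow hp hq (p ^ ·) _ fun _ => lam.factorization_lt_of_mem p,
      count_bind_replicate_pow hp hq (p ^ ·) _ fun _ => nu.factorization_lt_of_mem p] at hcount
    have := eq_of_sum_pow_mul_eq (n + 1) _ _ (fun i => hlam _) (fun i => hnu _) hcount
      (a.factorization p) ((Nat.factorization_lt p ha0.ne').trans_le (han.trans n.le_succ))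
    rwa [Nat.ordProj_mul_ordCompl_eq_self] at this
  · have hz (mu : n.Partition) : mu.parts.count a = 0 :=
      Multiset.count_eq_zero.2 fun h => ha ⟨mu.parts_pos h, mu.le_of_mem_parts h⟩
    rw [hz, hz]

lemma glaisherMap_bijective {p n : ℕ} (hp : p.Prime) :
    Function.Bijective (glaisherMap (n := n) hp) := by
  classical
  rw [Fintype.bijective_iff_injective_and_card]
  refine ⟨glaisherMap_injective hp, ?_⟩
  rw [Fintype.card_of_subtype (Nat.Partition.countRestricted n p),
    Fintype.card_of_subtype (Nat.Partition.restricted n (¬ p ∣ ·)),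
    Nat.Partition.card_restricted_eq_card_countRestricted n hp.pos]
  · intro mu
    simp [Nat.Partition.restricted, IsPClassRegular]
  · intro lam
    simp only [Nat.Partition.countRestricted, IsPRegular, Finset.mem_filter_univ]
    refine ⟨fun h a => ?_, fun h i _ => h i⟩
    by_cases ha : a ∈ lam.parts
    · exact h a ha
    · rw [Multiset.count_eq_zero.2 ha]
      exact hp.pos

/-- Legendre's formula summed over the multiplicities of the Glaisher image. -/
lemma card_glaisherParts {p n : ℕ} (hp : p.Prime) (lam : n.Partition) (hlam : IsPRegular p lam) :
    (glaisherParts p lam.parts).card = (p - 1) *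
      ∑ q ∈ (glaisherParts p lam.parts).toFinset,
        ((glaisherParts p lam.parts).count q).factorial.factorization p + lam.parts.card := by
  have := Fact.mk hp
  set s := lam.parts.bind fun a => Multiset.replicate 1 (a / p ^ a.factorization p) with hs
  have hcard : lam.parts.card = s.card := by simp [hs]
  have hmem : ∀ a ∈ s, a ∈ (glaisherParts p lam.parts).toFinset := by
    intro a ha
    simp only [hs, Multiset.mem_bind, Multiset.mem_replicate, glaisherParts,
      Multiset.mem_toFinset] at ha ⊢
    obtain ⟨b, hb, -, rfl⟩ := ha
    exact ⟨b, hb, pow_ne_zero _ hp.ne_zero, rfl⟩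
  rw [hcard, ← Multiset.sum_count_eq_card hmem, ← Multiset.toFinset_sum_count_eq,
    Finset.mul_sum, ← Finset.sum_add_distrib]
  refine Finset.sum_congr rfl fun q hq => ?_
  have hq : ¬ p ∣ q :=
    not_dvd_of_mem_glaisherParts hp (fun _ ha => lam.parts_pos ha) (Multiset.mem_toFinset.1 hq)
  have h1 : s.count q = ∑ i ∈ Finset.range (n + 1), lam.parts.count (p ^ i * q) := by
    simpa only [one_mul] using count_bind_replicate_pow hp hq (fun _ => 1) lam.parts
      fun _ => lam.factorization_lt_of_mem p
  have h2 : (glaisherParts p lam.parts).count q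
      = ∑ i ∈ Finset.range (n + 1), p ^ i * lam.parts.count (p ^ i * q) :=
    count_bind_replicate_pow hp hq (p ^ ·) lam.parts fun _ => lam.factorization_lt_of_mem p
  have h3 : (p.digits ((glaisherParts p lam.parts).count q)).sum = s.count q := by
    rw [h1, h2, sum_digits_sum_pow_mul hp.one_lt _ _ fun i => hlam _]
  rw [Nat.factorization_def _ hp, sub_one_mul_padicValNat_factorial, h3]
  have := Nat.digit_sum_le p ((glaisherParts p lam.parts).count q)
  omega

lemma Equiv.Perm.nat_card_centralizer_eq_prod_partition {α : Type*} [Fintype α] [DecidableEq α]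
    (g : Equiv.Perm α) :
    Nat.card (Subgroup.centralizer {g}) = g.partition.parts.prod *
      ∏ q ∈ g.partition.parts.toFinset, (g.partition.parts.count q).factorial := by
  have h1 : 1 ∉ g.cycleType := fun h => (Equiv.Perm.one_lt_of_mem_cycleType h).ne rfl
  have hsub : g.partition.parts.toFinset ⊆ insert 1 g.cycleType.toFinset := by
    intro a
    simp only [Equiv.Perm.parts_partition, Multiset.mem_toFinset, Multiset.mem_add,
      Multiset.mem_replicate, Finset.mem_insert]
    tauto
  rw [Finset.prod_subset hsub fun a _ ha => by
      rw [Multiset.count_eq_zero.2 (by simpa using ha), Nat.factorial_zero],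
    Finset.prod_insert (by simpa using h1), Equiv.Perm.nat_card_centralizer,
    Equiv.Perm.parts_partition, Equiv.Perm.sum_cycleType]
  have h2 : ∏ q ∈ g.cycleType.toFinset, (Multiset.count q (g.cycleType +
      Multiset.replicate (Fintype.card α - g.support.card) 1)).factorial
      = ∏ q ∈ g.cycleType.toFinset, (g.cycleType.count q).factorial := by
    refine Finset.prod_congr rfl fun q hq => ?_
    have : 1 ≠ q := fun h => h1 (h ▸ Multiset.mem_toFinset.1 hq)
    simp [Multiset.count_replicate, this]
  rw [h2, Multiset.count_add, Multiset.count_eq_zero.2 h1]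
  simp
  ring

lemma factorization_card_centralizer {p n : ℕ} (hp : p.Prime) (g : Equiv.Perm (Fin n))
    (hg : ∀ a ∈ g.partition.parts, ¬ p ∣ a) :
    (Nat.card (Subgroup.centralizer {g})).factorization p =
      ∑ q ∈ g.partition.parts.toFinset,
        (g.partition.parts.count q).factorial.factorization p := by
  have hprod : ¬ p ∣ g.partition.parts.prod := by
    intro h
    obtain ⟨a, ha, hpa⟩ := hp.prime.exists_mem_multiset_dvd h
    exact hg a ha hpa
  have h0 : g.partition.parts.prod ≠ 0 := fun h => hprod (h ▸ dvd_zero p)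
  rw [Equiv.Perm.nat_card_centralizer_eq_prod_partition,
    Nat.factorization_mul h0 (Finset.prod_ne_zero_iff.2 fun _ _ => Nat.factorial_ne_zero _),
    Finsupp.add_apply, Nat.factorization_eq_zero_of_not_dvd hprod, zero_add,
    Nat.factorization_prod fun _ _ => Nat.factorial_ne_zero _, Finset.sum_apply']

open scoped Classical in
/-- Choose, for each `p`-class regular partition `μ` of `n`, a permutation
`x_μ ∈ S_n` of cycle type `μ`.  Then the multiset of `p`-parts
`|Z_{S_n}(x_μ)|_p` (which, by Brauer's theorem, is the multiset of elementary
divisors of the `p`-Cartan matrix of `S_n`) equals the multiset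
`{p ^ ((ℓ(γ(λ)) − ℓ(λ))/(p − 1)) : λ a p-regular partition of n}`. -/
theorem cartan_elementary_divisors (p n : ℕ) (hp : p.Prime)
    (x : {mu : n.Partition // IsPClassRegular p mu} → Equiv.Perm (Fin n))
    (hx : ∀ mu, (Equiv.Perm.partition (x mu)).parts = mu.1.parts) :
    (Finset.univ.val.map
        (fun mu : {mu : n.Partition // IsPClassRegular p mu} =>
          p ^ ((Nat.card (Subgroup.centralizer
            ({x mu} : Set (Equiv.Perm (Fin n))))).factorization p)))
      = (Finset.univ.val.map
          (fun lam : {lam : n.Partition // IsPRegular p lam} =>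
            p ^ ((Multiset.card (glaisherParts p lam.1.parts)
              - Multiset.card lam.1.parts) / (p - 1)))) := by
  have hcomp : (fun lam : {lam : n.Partition // IsPRegular p lam} =>
      p ^ ((Multiset.card (glaisherParts p lam.1.parts) - Multiset.card lam.1.parts) / (p - 1)))
      = (fun mu : {mu : n.Partition // IsPClassRegular p mu} =>
          p ^ ((Nat.card (Subgroup.centralizer
            ({x mu} : Set (Equiv.Perm (Fin n))))).factorization p)) ∘ glaisherMap hp := by
    funext lam
    simp only [Function.comp_apply]
    have hparts := hx (glaisherMap hp lam)
    rw [factorization_card_centralizer hp _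
      (by rw [hparts]; exact (glaisherMap hp lam).2), hparts,
      card_glaisherParts hp lam.1 lam.2, Nat.add_sub_cancel,
      Nat.mul_div_cancel_left _ (Nat.sub_pos_of_lt hp.one_lt)]
    rfl
  rw [hcomp, ← Multiset.map_map]
  congr 1
  exact (congrArg Finset.val (Finset.map_univ_equiv
    (Equiv.ofBijective _ (glaisherMap_bijective hp)))).symm
end

section
/- Let λ be a strict partition of n (all parts distinct) and let μ be a strict partition with 2μ = λ^{(2)}, i.e., the even parts of λ are exactly twice the parts of μ. Let x ∈ S_n be a permutation with cycle type γ(λ), where γ is the Glaisher map for p = 2. Then the 2-part of the order of the centralizer of x in S_n is |Z_{S_n}(x)|_2 = 2^{ℓ(γ(2μ)) − ℓ(2μ)} = 2^{ℓ(γ(λ)) − ℓ(λ)}. -/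
open Finset in
theorem Nat.factorization_two_factorial_sum_two_pow (S : Finset ℕ) :
    (Nat.factorial (∑ i ∈ S, 2 ^ i)).factorization 2 + #S = ∑ i ∈ S, 2 ^ i := by
  have digits_sum : ((Nat.digits 2 (∑ i ∈ S, 2 ^ i)).sum = #S) := by
    induction S using Finset.induction_on_max with
    | empty => simp
    | insert a s hs ih =>
      have ha : a ∉ s := fun h => lt_irrefl _ (hs a h)
      have hlt : ∑ i ∈ s, 2 ^ i < 2 ^ a := Nat.geomSum_lt le_rfl hs
      have hlen := (Nat.digits_length_le_iff (b := 2) (by norm_num) (∑ i ∈ s, 2 ^ i)).2 hlt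
      have h := Nat.digits_append_zeroes_append_digits (b := 2)
        (k := a - (Nat.digits 2 (∑ i ∈ s, 2 ^ i)).length) (m := 1)
        (n := ∑ i ∈ s, 2 ^ i) (by norm_num) (by norm_num)
      rw [Nat.add_sub_cancel' hlen, mul_one] at h
      rw [sum_insert ha, card_insert_of_notMem ha, add_comm, ← h]
      simp [ih]
  have h := sub_one_mul_padicValNat_factorial (p := 2) (∑ i ∈ S, 2 ^ i)
  have hle := Nat.digit_sum_le 2 (∑ i ∈ S, 2 ^ i)
  rw [digits_sum] at h hle
  rw [Nat.factorization_def _ Nat.prime_two]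
  omega

open Finset in
theorem Equiv.Perm.nat_card_centralizer_eq_partition {α : Type*} [Fintype α] [DecidableEq α]
    (x : Equiv.Perm α) :
    Nat.card (Subgroup.centralizer ({x} : Set (Equiv.Perm α))) =
      x.partition.parts.prod *
        ∏ q ∈ x.partition.parts.toFinset, (x.partition.parts.count q).factorial := by
  have h1 : 1 ∉ x.cycleType := fun h => by
    have := Equiv.Perm.two_le_of_mem_cycleType h
    omega
  have hprod : ∏ q ∈ x.partition.parts.toFinset, (x.partition.parts.count q).factorial =
      ∏ q ∈ insert 1 x.cycleType.toFinset, (x.partition.parts.count q).factorial := by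
    refine prod_subset (fun q hq => ?_) (fun q _ hq => ?_)
    · rw [Multiset.mem_toFinset, Equiv.Perm.parts_partition, Multiset.mem_add] at hq
      rcases hq with hq | hq
      · simp [hq]
      · simp [Multiset.eq_of_mem_replicate hq]
    · rw [Multiset.mem_toFinset] at hq
      rw [Multiset.count_eq_zero_of_notMem hq, Nat.factorial_zero]
  rw [hprod, prod_insert (by simpa using h1), Equiv.Perm.nat_card_centralizer,
    Equiv.Perm.parts_partition, Multiset.prod_add, Multiset.prod_replicate, one_pow, mul_one,
    Multiset.count_add, Multiset.count_eq_zero_of_notMem h1, Multiset.count_replicate_self,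
    zero_add, ← Equiv.Perm.sum_cycleType, mul_comm (Nat.factorial _), mul_assoc]
  congr 2
  refine prod_congr rfl fun q hq => ?_
  have hq1 : q ≠ 1 := fun h => h1 (by simpa [h] using hq)
  rw [Multiset.count_add, Multiset.count_replicate, if_neg hq1.symm, add_zero]

theorem count_glaisherParts (p q : ℕ) (s : Multiset ℕ) :
    (glaisherParts p s).count q =
      ((s.filter fun a => a / p ^ a.factorization p = q).map
        fun a => p ^ a.factorization p).sum := by
  induction s using Multiset.induction_on with
  | empty => simp [glaisherParts]
  | cons a s ih =>
    rw [glaisherParts, Multiset.cons_bind, Multiset.count_add, ← glaisherParts, ih,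
      Multiset.count_replicate, Multiset.filter_cons]
    split_ifs <;> simp

theorem odd_of_mem_glaisherParts {s : Multiset ℕ} (hs : 0 ∉ s) {q : ℕ}
    (hq : q ∈ glaisherParts 2 s) : ¬ 2 ∣ q := by
  obtain ⟨a, ha, hq⟩ := Multiset.mem_bind.1 hq
  rw [Multiset.eq_of_mem_replicate hq]
  exact Nat.not_dvd_ordCompl Nat.prime_two (fun h => hs (h ▸ ha))

open Finset in
theorem factorization_factorial_count_glaisherParts (s : Finset ℕ) (q : ℕ) :
    (Nat.factorial ((glaisherParts 2 s.val).count q)).factorization 2 +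
      #{a ∈ s | a / 2 ^ a.factorization 2 = q} = (glaisherParts 2 s.val).count q := by
  have hinj : Set.InjOn (fun a : ℕ => a.factorization 2)
      ({a ∈ s | a / 2 ^ a.factorization 2 = q} : Finset ℕ) := by
    intro a ha b hb hab
    rw [mem_coe, mem_filter] at ha hb
    have hab : a.factorization 2 = b.factorization 2 := hab
    rw [← Nat.ordProj_mul_ordCompl_eq_self a 2, ← Nat.ordProj_mul_ordCompl_eq_self b 2,
      ha.2, hb.2, hab]
  have hcount : (glaisherParts 2 s.val).count q =
      ∑ i ∈ ({a ∈ s | a / 2 ^ a.factorization 2 = q} : Finset ℕ).image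
        (fun a : ℕ => a.factorization 2), 2 ^ i := by
    rw [count_glaisherParts, sum_image hinj]
    rfl
  rw [hcount, ← card_image_of_injOn hinj]
  exact Nat.factorization_two_factorial_sum_two_pow _

open Finset in
theorem sum_factorization_factorial_count_glaisherParts (s : Finset ℕ) :
    ∑ q ∈ (glaisherParts 2 s.val).toFinset,
        (Nat.factorial ((glaisherParts 2 s.val).count q)).factorization 2 + #s =
      Multiset.card (glaisherParts 2 s.val) := by
  have hmaps : ∀ a ∈ s, a / 2 ^ a.factorization 2 ∈ (glaisherParts 2 s.val).toFinset := by
    intro a ha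
    rw [Multiset.mem_toFinset, glaisherParts, Multiset.mem_bind]
    exact ⟨a, ha, Multiset.mem_replicate.2 ⟨by positivity, rfl⟩⟩
  rw [card_eq_sum_card_fiberwise hmaps, ← sum_add_distrib, ← Multiset.toFinset_sum_count_eq]
  exact sum_congr rfl fun q _ => factorization_factorial_count_glaisherParts s q

theorem glaisherParts_add (p : ℕ) (s t : Multiset ℕ) :
    glaisherParts p (s + t) = glaisherParts p s + glaisherParts p t :=
  Multiset.add_bind _ _ _

theorem glaisherParts_eq_self {p : ℕ} {s : Multiset ℕ} (hs : ∀ a ∈ s, ¬ p ∣ a) :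
    glaisherParts p s = s := by
  rw [glaisherParts, Multiset.bind_congr (g := fun a => {a}) fun a ha => ?_,
    Multiset.bind_singleton, Multiset.map_id']
  rw [Nat.factorization_eq_zero_of_not_dvd (hs a ha), pow_zero, Nat.div_one]
  rfl

/-- Let `λ` be a strict partition of `n`, let `μ` be the strict partition with
`2μ = λ⁽²⁾` (the even parts of `λ` are exactly twice the parts of `μ`), and let
`x ∈ S_n` have cycle type `γ(λ)`, where `γ` is the Glaisher map for `p = 2`.
Then the 2-part of `|Z_{S_n}(x)|` is
`2 ^ (ℓ(γ(2μ)) − ℓ(2μ)) = 2 ^ (ℓ(γ(λ)) − ℓ(λ))`. -/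
theorem centralizer_two_part (n : ℕ) (lam : n.Partition)
    (hlam : lam.parts.Nodup)
    (mu : Multiset ℕ) (hmu : mu.Nodup)
    (h2mu : mu.map (2 * ·) = lam.parts.filter (fun r => 2 ∣ r))
    (x : Equiv.Perm (Fin n))
    (hx : (Equiv.Perm.partition x).parts = glaisherParts 2 lam.parts) :
    2 ^ ((Nat.card (Subgroup.centralizer
          ({x} : Set (Equiv.Perm (Fin n))))).factorization 2)
        = 2 ^ (Multiset.card (glaisherParts 2 (mu.map (2 * ·)))
            - Multiset.card (mu.map (2 * ·))) ∧
    2 ^ ((Nat.card (Subgroup.centralizer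
          ({x} : Set (Equiv.Perm (Fin n))))).factorization 2)
        = 2 ^ (Multiset.card (glaisherParts 2 lam.parts)
            - Multiset.card lam.parts) := by
  have hzero : 0 ∉ lam.parts := fun h => lt_irrefl _ (lam.parts_pos h)
  have hval : (Nat.card (Subgroup.centralizer
      ({x} : Set (Equiv.Perm (Fin n))))).factorization 2 =
      Multiset.card (glaisherParts 2 lam.parts) - Multiset.card lam.parts := by
    have hodd : ¬ 2 ∣ (glaisherParts 2 lam.parts).prod := fun h => by
      obtain ⟨q, hq, hdvd⟩ := Nat.prime_two.prime.exists_mem_multiset_dvd h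
      exact odd_of_mem_glaisherParts hzero hq hdvd
    have hne : (glaisherParts 2 lam.parts).prod ≠ 0 := fun h => hodd (h ▸ dvd_zero 2)
    have hsum := sum_factorization_factorial_count_glaisherParts ⟨lam.parts, hlam⟩
    simp only [Finset.card_mk] at hsum
    rw [Equiv.Perm.nat_card_centralizer_eq_partition, hx,
      Nat.factorization_mul hne (Finset.prod_ne_zero_iff.2 fun q _ => Nat.factorial_ne_zero _),
      Finsupp.add_apply, Nat.factorization_eq_zero_of_not_dvd hodd, zero_add,
      Nat.factorization_prod_apply fun q _ => Nat.factorial_ne_zero _]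
    exact Nat.eq_sub_of_add_eq hsum
  have hsplit : Multiset.card (glaisherParts 2 lam.parts) - Multiset.card lam.parts =
      Multiset.card (glaisherParts 2 (mu.map (2 * ·))) - Multiset.card (mu.map (2 * ·)) := by
    rw [h2mu]
    conv_lhs => rw [← Multiset.filter_add_not (fun r => 2 ∣ r) lam.parts]
    rw [glaisherParts_add, Multiset.card_add, Multiset.card_add,
      glaisherParts_eq_self fun a ha => (Multiset.mem_filter.1 ha).2, Nat.add_sub_add_right]
  exact ⟨by rw [hval, hsplit], by rw [hval]⟩
end
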